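/- arXiv:1904.03440 — 2 statements merged into one kernel-verified Lean document; each statement's English description precedes it below -/
import Mathlib

section
/- Let Σ_Λ = {Σ_λ = (γ_λ,f_λ,g_λ)}_{λ∈Λ} be a parametrized family of impulsive systems with inputs and let h, h⁰ ∈ H. If the set Γ_Λ = {γ_λ : λ ∈ Λ} is uniformly incrementally bounded (UIB), then Σ_Λ is strongly (h⁰,h)-ISS if and only if it is weakly (h⁰,h)-ISS. -/
open MeasureTheory Filter Set
open scoped Classical

noncomputable section

/-- State/input spaces: `ℝ^k` with the Euclidean norm. -/
abbrev Stt (k : ℕ) : Type := EuclideanSpace ℝ (Fin k)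

/-- An impulse-time sequence, identified with its (locally finite) set of impulse
times, a subset of `(0,∞)` with finitely many points below any bound. -/
def IsImpulseSeq (γ : Set ℝ) : Prop :=
  γ ⊆ Set.Ioi (0 : ℝ) ∧ ∀ T : ℝ, (γ ∩ Set.Iic T).Finite

/-- `n^γ_{(s,t]}`: the number of impulse times in the interval `(s,t]`. -/
def nJumps (γ : Set ℝ) (s t : ℝ) : ℕ := (γ ∩ Set.Ioc s t).ncard

/-- Uniform incremental boundedness of a set of impulse-time sequences. -/
def UIB (S : Set (Set ℝ)) : Prop :=
  ∃ φ : ℝ → ℝ, ContinuousOn φ (Set.Ici 0) ∧ MonotoneOn φ (Set.Ici 0) ∧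
    (∀ s : ℝ, 0 ≤ s → 0 ≤ φ s) ∧
    ∀ γ ∈ S, ∀ t0 t : ℝ, 0 ≤ t0 → t0 < t → (nJumps γ t0 t : ℝ) ≤ φ (t - t0)

/-- Class `K∞` functions `[0,∞) → [0,∞)`. -/
def ClassKInf (α : ℝ → ℝ) : Prop :=
  ContinuousOn α (Set.Ici 0) ∧ StrictMonoOn α (Set.Ici 0) ∧ α 0 = 0 ∧
    ∀ M : ℝ, ∃ r : ℝ, 0 ≤ r ∧ M ≤ α r

/-- Class `KL` functions. -/
def ClassKL (β : ℝ → ℝ → ℝ) : Prop :=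
  (∀ t : ℝ, 0 ≤ t → ClassKInf fun r => β r t) ∧
  ∀ r : ℝ, 0 ≤ r → AntitoneOn (fun t => β r t) (Set.Ici 0) ∧
    Filter.Tendsto (fun t => β r t) Filter.atTop (nhds 0)

/-- Positive definite functions `[0,∞) → [0,∞)`. -/
def PosDef (ρ : ℝ → ℝ) : Prop :=
  ContinuousOn ρ (Set.Ici 0) ∧ ρ 0 = 0 ∧ ∀ r : ℝ, 0 < r → 0 < ρ r

/-- Locally integrable (on compacts) function `[0,∞) → ℝ` (extended to `ℝ`). -/
def LocIntegrable (p : ℝ → ℝ) : Prop :=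
  ∀ a b : ℝ, MeasureTheory.IntegrableOn p (Set.Icc a b)

/-- Inputs: measurable, locally essentially bounded functions. -/
def IsInput {m : ℕ} (u : ℝ → Stt m) : Prop :=
  Measurable u ∧ ∀ T : ℝ, ∃ C : ℝ, ∀ᵐ t ∂MeasureTheory.volume, t ∈ Set.Icc 0 T → ‖u t‖ ≤ C

/-- `‖u_I‖_γ`: max of the essential supremum of `‖u‖` over `I` and the supremum of
`‖u‖` over `γ ∩ I`. -/
def inputNorm {m : ℕ} (γ : Set ℝ) (u : ℝ → Stt m) (I : Set ℝ) : ℝ :=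
  max (essSup (fun t => ‖u t‖) (MeasureTheory.volume.restrict I))
      (sSup ((fun t => ‖u t‖) '' (γ ∩ I)))

/-- Solution of the impulsive system `(γ,f,g)` on `[t0,T)` with initial state `x0`
and input `u` (Carathéodory solutions, in integral form, between impulses). -/
structure IsSolution {n m : ℕ} (γ : Set ℝ) (f g : ℝ → Stt n → Stt m → Stt n)
    (t0 : ℝ) (x0 : Stt n) (u : ℝ → Stt m) (T : EReal) (x : ℝ → Stt n) : Prop where
  lt : (t0 : EReal) < T
  init : x t0 = x0
  flow : ∀ t1 t2 : ℝ, t0 ≤ t1 → t1 ≤ t2 → (t2 : EReal) < T → Set.Ioc t1 t2 ∩ γ = ∅ →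
    MeasureTheory.IntegrableOn (fun s => f s (x s) (u s)) (Set.Icc t1 t2) ∧
    x t2 = x t1 + ∫ s in t1..t2, f s (x s) (u s)
  jump : ∀ t ∈ γ, t0 < t → (t : EReal) < T →
    ∃ L : Stt n, Filter.Tendsto x (nhdsWithin t (Set.Iio t)) (nhds L) ∧
      x t = L + g t L (u t)

/-- Maximally defined solution. -/
def IsMaxSolution {n m : ℕ} (γ : Set ℝ) (f g : ℝ → Stt n → Stt m → Stt n)
    (t0 : ℝ) (x0 : Stt n) (u : ℝ → Stt m) (T : EReal) (x : ℝ → Stt n) : Prop :=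
  IsSolution γ f g t0 x0 u T x ∧
    ∀ (T' : EReal) (x' : ℝ → Stt n), IsSolution γ f g t0 x0 u T' x' →
      (∀ t : ℝ, t0 ≤ t → (t : EReal) < T → x' t = x t) → T' ≤ T

/-- Weak `(h⁰,h)`-ISS of a parametrized family of impulsive systems. -/
def WeaklyISS {n m : ℕ} {Λ : Type*} (γ : Λ → Set ℝ)
    (f g : Λ → ℝ → Stt n → Stt m → Stt n) (h0 h : ℝ → Stt n → ℝ) : Prop :=
  ∃ β : ℝ → ℝ → ℝ, ∃ ρ : ℝ → ℝ, ClassKL β ∧ ClassKInf ρ ∧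
    ∀ (l : Λ) (t0 : ℝ) (x0 : Stt n) (u : ℝ → Stt m) (T : EReal) (x : ℝ → Stt n),
      0 ≤ t0 → IsInput u → IsMaxSolution (γ l) (f l) (g l) t0 x0 u T x →
      ∀ t : ℝ, t0 ≤ t → (t : EReal) < T →
        h t (x t) ≤ β (h0 t0 x0) (t - t0) + ρ (inputNorm (γ l) u (Set.Ioc t0 t))

/-- Strong `(h⁰,h)`-ISS of a parametrized family of impulsive systems. -/
def StronglyISS {n m : ℕ} {Λ : Type*} (γ : Λ → Set ℝ)
    (f g : Λ → ℝ → Stt n → Stt m → Stt n) (h0 h : ℝ → Stt n → ℝ) : Prop :=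
  ∃ β : ℝ → ℝ → ℝ, ∃ ρ : ℝ → ℝ, ClassKL β ∧ ClassKInf ρ ∧
    ∀ (l : Λ) (t0 : ℝ) (x0 : Stt n) (u : ℝ → Stt m) (T : EReal) (x : ℝ → Stt n),
      0 ≤ t0 → IsInput u → IsMaxSolution (γ l) (f l) (g l) t0 x0 u T x →
      ∀ t : ℝ, t0 ≤ t → (t : EReal) < T →
        h t (x t) ≤ β (h0 t0 x0) (t - t0 + (nJumps (γ l) t0 t : ℝ)) +
          ρ (inputNorm (γ l) u (Set.Ioc t0 t))

/-- Locally Lipschitz on a set. -/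
def LocLipschitzOn {α β : Type*} [PseudoEMetricSpace α] [PseudoEMetricSpace β]
    (s : Set α) (f : α → β) : Prop :=
  ∀ x ∈ s, ∃ K : NNReal, ∃ t ∈ nhdsWithin x s, LipschitzOnWith K f t

/-- `V ∈ V(γ)` with `Vm` its left-limit function at impulse times: `V` is locally
Lipschitz on each inter-impulse strip and has the joint left limit `Vm τ ξ`
at each `τ ∈ γ`. -/
def InClassV {n : ℕ} (γ : Set ℝ) (V Vm : ℝ → Stt n → ℝ) : Prop :=
  (∀ a b : ℝ, 0 ≤ a → Set.Ioo a b ∩ γ = ∅ →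
    LocLipschitzOn (Set.Ico a b ×ˢ (Set.univ : Set (Stt n)))
      (fun q : ℝ × Stt n => V q.1 q.2)) ∧
  ∀ τ ∈ γ, ∀ ξ : Stt n,
    Filter.Tendsto (fun q : ℝ × Stt n => V q.1 q.2)
      (nhdsWithin (τ, ξ) (Set.Iio τ ×ˢ (Set.univ : Set (Stt n)))) (nhds (Vm τ ξ))

/-- Upper-right Dini derivative of `V` along the flow map `f`. -/
def DiniAlong {n m : ℕ} (f : ℝ → Stt n → Stt m → Stt n) (V : ℝ → Stt n → ℝ)
    (t : ℝ) (ξ : Stt n) (μ : Stt m) : ℝ :=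
  Filter.limsup (fun d : ℝ => (V (t + d) (ξ + d • f t ξ μ) - V t ξ) / d)
    (nhdsWithin 0 (Set.Ioi 0))

/-- Carathéodory function `[0,∞) × [0,∞) → ℝ`. -/
def Caratheodory2 (φ : ℝ → ℝ → ℝ) : Prop :=
  (∀ r : ℝ, Measurable fun t => φ t r) ∧
  (∀ t : ℝ, ContinuousOn (φ t) (Set.Ici 0)) ∧
  ∀ a b c : ℝ, ∃ mK : ℝ → ℝ, MeasureTheory.IntegrableOn mK (Set.Icc a b) ∧
    ∀ t ∈ Set.Icc a b, ∀ r ∈ Set.Icc (0 : ℝ) c, |φ t r| ≤ mK t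

/-- Assumption 1 of the paper, with all the data explicit. -/
def Assumption1 {n m : ℕ} {Λ : Type*} (γ : Λ → Set ℝ)
    (f g : Λ → ℝ → Stt n → Stt m → Stt n) (h0 h : ℝ → Stt n → ℝ)
    (V Vm : Λ → ℝ → Stt n → ℝ) (φ1 φ2 χ π : ℝ → ℝ)
    (vφ al : Λ → ℝ → ℝ → ℝ) : Prop :=
  ClassKInf φ1 ∧ ClassKInf φ2 ∧ ClassKInf χ ∧ ClassKInf π ∧
  (∀ l : Λ, InClassV (γ l) (V l) (Vm l)) ∧
  (∀ l : Λ, Caratheodory2 (vφ l)) ∧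
  (∀ (l : Λ) (t r : ℝ), 0 ≤ t → 0 ≤ r → 0 ≤ al l t r) ∧
  (∀ (l : Λ) (t : ℝ) (ξ : Stt n), 0 ≤ t →
    φ1 (h t ξ) ≤ V l t ξ ∧ V l t ξ ≤ φ2 (h0 t ξ)) ∧
  (∀ (l : Λ) (t : ℝ) (ξ : Stt n) (μ : Stt m), 0 ≤ t → t ∉ γ l → χ ‖μ‖ ≤ V l t ξ →
    DiniAlong (f l) (V l) t ξ μ ≤ - vφ l t (V l t ξ)) ∧
  (∀ (l : Λ) (t : ℝ) (ξ : Stt n) (μ : Stt m), t ∈ γ l → χ ‖μ‖ ≤ Vm l t ξ →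
    V l t (ξ + g l t ξ μ) ≤ al l t (Vm l t ξ)) ∧
  (∀ (l : Λ) (t : ℝ) (ξ : Stt n) (μ : Stt m), t ∈ γ l → Vm l t ξ ≤ χ ‖μ‖ →
    V l t (ξ + g l t ξ μ) ≤ π ‖μ‖)

/-- Solution of the scalar comparison differential/difference inclusion. -/
structure IsCompSol (γ : Set ℝ) (vφ al : ℝ → ℝ → ℝ) (t0 z0 : ℝ) (T : EReal)
    (z : ℝ → ℝ) : Prop where
  lt : (t0 : EReal) < T
  init : z t0 = z0
  nonneg : ∀ t : ℝ, t0 ≤ t → (t : EReal) < T → 0 ≤ z t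
  flow : ∀ t1 t2 : ℝ, t0 ≤ t1 → t1 ≤ t2 → (t2 : EReal) < T → Set.Ioc t1 t2 ∩ γ = ∅ →
    ∃ d : ℝ → ℝ, MeasureTheory.IntegrableOn d (Set.Icc t1 t2) ∧
      (∀ᵐ s ∂MeasureTheory.volume, s ∈ Set.Icc t1 t2 → d s ≤ - vφ s (z s)) ∧
      ∀ t ∈ Set.Icc t1 t2, z t = z t1 + ∫ s in t1..t, d s
  jump : ∀ t ∈ γ, t0 < t → (t : EReal) < T →
    ∃ L : ℝ, Filter.Tendsto z (nhdsWithin t (Set.Iio t)) (nhds L) ∧ z t ≤ al t L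

/-- The family of comparison systems is weakly GUAS. -/
def CompWeakGUAS {Λ : Type*} (γ : Λ → Set ℝ) (vφ al : Λ → ℝ → ℝ → ℝ) : Prop :=
  ∃ β : ℝ → ℝ → ℝ, ClassKL β ∧
    ∀ (l : Λ) (t0 z0 : ℝ) (T : EReal) (z : ℝ → ℝ), 0 ≤ t0 → 0 ≤ z0 →
      IsCompSol (γ l) (vφ l) (al l) t0 z0 T z →
      ∀ t : ℝ, t0 ≤ t → (t : EReal) < T → z t ≤ β z0 (t - t0)

/-- The family of comparison systems is strongly GUAS. -/
def CompStrongGUAS {Λ : Type*} (γ : Λ → Set ℝ) (vφ al : Λ → ℝ → ℝ → ℝ) : Prop :=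
  ∃ β : ℝ → ℝ → ℝ, ClassKL β ∧
    ∀ (l : Λ) (t0 z0 : ℝ) (T : EReal) (z : ℝ → ℝ), 0 ≤ t0 → 0 ≤ z0 →
      IsCompSol (γ l) (vφ l) (al l) t0 z0 T z →
      ∀ t : ℝ, t0 ≤ t → (t : EReal) < T → z t ≤ β z0 (t - t0 + (nJumps (γ l) t0 t : ℝ))

/-- Nonnegative Carathéodory solution of the scalar ODE `ẇ = rhs(t,w)` on `[t0,T)`. -/
structure IsODESol (rhs : ℝ → ℝ → ℝ) (t0 : ℝ) (T : EReal) (w : ℝ → ℝ) : Prop where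
  lt : (t0 : EReal) < T
  nonneg : ∀ t : ℝ, t0 ≤ t → (t : EReal) < T → 0 ≤ w t
  flow : ∀ t1 t2 : ℝ, t0 ≤ t1 → t1 ≤ t2 → (t2 : EReal) < T →
    IntervalIntegrable (fun s => rhs s (w s)) MeasureTheory.volume t1 t2 ∧
    w t2 = w t1 + ∫ s in t1..t2, rhs s (w s)

/-- Maximally defined forward-in-time solution of `ẇ = rhs(t,w)`. -/
def IsMaxODESol (rhs : ℝ → ℝ → ℝ) (t0 : ℝ) (T : EReal) (w : ℝ → ℝ) : Prop :=
  IsODESol rhs t0 T w ∧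
    ∀ (T' : EReal) (w' : ℝ → ℝ), IsODESol rhs t0 T' w' →
      (∀ t : ℝ, t0 ≤ t → (t : EReal) < T → w' t = w t) → T' ≤ T

/-- GUAS of the family of scalar ODEs `ẇ = −φ_λ(t,w)`. -/
def ODEFamilyGUAS {Λ : Type*} (vφ : Λ → ℝ → ℝ → ℝ) : Prop :=
  ∃ β : ℝ → ℝ → ℝ, ClassKL β ∧
    ∀ (l : Λ) (t0 : ℝ) (T : EReal) (w : ℝ → ℝ), 0 ≤ t0 →
      IsMaxODESol (fun s r => -(vφ l s r)) t0 T w →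
      T = (⊤ : EReal) ∧ ∀ t : ℝ, t0 ≤ t → w t ≤ β (w t0) (t - t0)

/-- Solution (on all of `[0,∞)`) of the scalar linear ODE `ẇ = −p(t)·w`. -/
def IsLinSol (p : ℝ → ℝ) (w : ℝ → ℝ) : Prop :=
  ∀ t1 t2 : ℝ, 0 ≤ t1 → t1 ≤ t2 →
    IntervalIntegrable (fun s => p s * w s) MeasureTheory.volume t1 t2 ∧
    w t2 = w t1 + ∫ s in t1..t2, -(p s * w s)

/-- An impulsive and switching sequence, described through its impulse-time set,
its two switching signals (constant between impulses), and the left limit of the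
first switching signal at impulse times. -/
structure SwSignal (Ic Id : Type*) where
  γ : Set ℝ
  σ1 : ℝ → Ic
  σ1m : ℝ → Ic
  σ2 : ℝ → Id
  impulse : IsImpulseSeq γ
  const1 : ∀ a b : ℝ, 0 ≤ a → Set.Ioo a b ∩ γ = ∅ → ∀ t ∈ Set.Ico a b, σ1 t = σ1 a
  const2 : ∀ a b : ℝ, 0 ≤ a → Set.Ioo a b ∩ γ = ∅ → ∀ t ∈ Set.Ico a b, σ2 t = σ2 a
  leftlim : ∀ t ∈ γ, ∀ᶠ s in nhdsWithin t (Set.Iio t), σ1 s = σ1m t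

/-- `σ ∈ SW(J)`. -/
def InSW {Ic Id : Type*} (σ : SwSignal Ic Id) (J : Set (Ic × Ic × Id)) : Prop :=
  ∀ t ∈ σ.γ, (σ.σ1m t, σ.σ1 t, σ.σ2 t) ∈ J

/-- Flow map of the switched impulsive system `Σ_σ`. -/
def swF {n m : ℕ} {Ic Id : Type*} (F : Ic → ℝ → Stt n → Stt m → Stt n)
    (σ : SwSignal Ic Id) : ℝ → Stt n → Stt m → Stt n :=
  fun t ξ μ => F (σ.σ1 t) t ξ μ

/-- Jump map of the switched impulsive system `Σ_σ`. -/
def swG {n m : ℕ} {Ic Id : Type*} (G : Id → ℝ → Stt n → Stt m → Stt n)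
    (σ : SwSignal Ic Id) : ℝ → Stt n → Stt m → Stt n :=
  fun t ξ μ => G (σ.σ2 t) t ξ μ

/-- Weak `(h⁰,h)`-ISS of the family `{Σ_σ}_{σ ∈ SW}`. -/
def SwWeaklyISS {n m : ℕ} {Ic Id : Type*} (F : Ic → ℝ → Stt n → Stt m → Stt n)
    (G : Id → ℝ → Stt n → Stt m → Stt n) (SW : Set (SwSignal Ic Id))
    (h0 h : ℝ → Stt n → ℝ) : Prop :=
  ∃ β : ℝ → ℝ → ℝ, ∃ ρ : ℝ → ℝ, ClassKL β ∧ ClassKInf ρ ∧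
    ∀ σ ∈ SW, ∀ (t0 : ℝ) (x0 : Stt n) (u : ℝ → Stt m) (T : EReal) (x : ℝ → Stt n),
      0 ≤ t0 → IsInput u → IsMaxSolution σ.γ (swF F σ) (swG G σ) t0 x0 u T x →
      ∀ t : ℝ, t0 ≤ t → (t : EReal) < T →
        h t (x t) ≤ β (h0 t0 x0) (t - t0) + ρ (inputNorm σ.γ u (Set.Ioc t0 t))

/-- Strong `(h⁰,h)`-ISS of the family `{Σ_σ}_{σ ∈ SW}`. -/
def SwStronglyISS {n m : ℕ} {Ic Id : Type*} (F : Ic → ℝ → Stt n → Stt m → Stt n)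
    (G : Id → ℝ → Stt n → Stt m → Stt n) (SW : Set (SwSignal Ic Id))
    (h0 h : ℝ → Stt n → ℝ) : Prop :=
  ∃ β : ℝ → ℝ → ℝ, ∃ ρ : ℝ → ℝ, ClassKL β ∧ ClassKInf ρ ∧
    ∀ σ ∈ SW, ∀ (t0 : ℝ) (x0 : Stt n) (u : ℝ → Stt m) (T : EReal) (x : ℝ → Stt n),
      0 ≤ t0 → IsInput u → IsMaxSolution σ.γ (swF F σ) (swG G σ) t0 x0 u T x →
      ∀ t : ℝ, t0 ≤ t → (t : EReal) < T →
        h t (x t) ≤ β (h0 t0 x0) (t - t0 + (nJumps σ.γ t0 t : ℝ)) +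
          ρ (inputNorm σ.γ u (Set.Ioc t0 t))

/-- Total activation time in `(t0,t]` of the flow modes in `A`. -/
def actT {Ic Id : Type*} (σ : SwSignal Ic Id) (A : Set Ic) (t0 t : ℝ) : ℝ :=
  (MeasureTheory.volume {r : ℝ | r ∈ Set.Ioc t0 t ∧ σ.σ1 r ∈ A}).toReal

/-- Number of impulse times in `(t0,t]` whose mode combination lies in `Jp`. -/
def nJumpsIn {Ic Id : Type*} (σ : SwSignal Ic Id) (Jp : Set (Ic × Ic × Id))
    (t0 t : ℝ) : ℕ :=
  (σ.γ ∩ Set.Ioc t0 t ∩ {r : ℝ | (σ.σ1m r, σ.σ1 r, σ.σ2 r) ∈ Jp}).ncard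

/-- Assumption 2 of the paper (for switched impulsive systems), data explicit. -/
def Assumption2 {n m : ℕ} {Ic Id : Type*}
    (F : Ic → ℝ → Stt n → Stt m → Stt n) (G : Id → ℝ → Stt n → Stt m → Stt n)
    (h0 h : ℝ → Stt n → ℝ) (J : Set (Ic × Ic × Id))
    (v : Ic → ℝ → Stt n → ℝ) (φ1 φ2 χ π : ℝ → ℝ)
    (vφ : Ic → ℝ → ℝ → ℝ) (al : Ic × Ic × Id → ℝ → ℝ → ℝ) : Prop :=
  ClassKInf φ1 ∧ ClassKInf φ2 ∧ ClassKInf χ ∧ ClassKInf π ∧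
  (∀ i : Ic, LocLipschitzOn ((Set.Ici (0 : ℝ)) ×ˢ (Set.univ : Set (Stt n)))
      (fun q : ℝ × Stt n => v i q.1 q.2)) ∧
  (∀ i : Ic, Caratheodory2 (vφ i)) ∧
  (∀ e ∈ J, ∀ t r : ℝ, 0 ≤ t → 0 ≤ r → 0 ≤ al e t r) ∧
  (∀ (i : Ic) (t : ℝ) (ξ : Stt n), 0 ≤ t →
    φ1 (h t ξ) ≤ v i t ξ ∧ v i t ξ ≤ φ2 (h0 t ξ)) ∧
  (∀ (i : Ic) (t : ℝ) (ξ : Stt n) (μ : Stt m), 0 ≤ t → χ ‖μ‖ ≤ v i t ξ →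
    DiniAlong (F i) (v i) t ξ μ ≤ - vφ i t (v i t ξ)) ∧
  (∀ (ι i : Ic) (j : Id), (ι, i, j) ∈ J → ∀ (t : ℝ) (ξ : Stt n) (μ : Stt m),
    0 ≤ t → χ ‖μ‖ ≤ v ι t ξ → v i t (ξ + G j t ξ μ) ≤ al (ι, i, j) t (v ι t ξ)) ∧
  (∀ (ι i : Ic) (j : Id), (ι, i, j) ∈ J → ∀ (t : ℝ) (ξ : Stt n) (μ : Stt m),
    0 ≤ t → v ι t ξ ≤ χ ‖μ‖ → v i t (ξ + G j t ξ μ) ≤ π ‖μ‖)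

/-- A nondecreasing gain `φ` on elapsed time admits a generalized inverse of `s ↦ s + φ s`. -/
theorem exists_time_rescaling {φ : ℝ → ℝ} (hmono : MonotoneOn φ (Set.Ici 0))
    (hnonneg : ∀ s : ℝ, 0 ≤ s → 0 ≤ φ s) :
    ∃ σ : ℝ → ℝ, (∀ τ, 0 ≤ τ → 0 ≤ σ τ) ∧ MonotoneOn σ (Set.Ici 0) ∧
      Filter.Tendsto σ Filter.atTop Filter.atTop ∧
      ∀ s τ, 0 ≤ s → τ ≤ s + φ s → σ τ ≤ s := by
  let A : ℝ → Set ℝ := fun τ => {s | 0 ≤ s ∧ τ ≤ s + φ s}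
  have hbdd : ∀ τ, BddBelow (A τ) := fun τ => ⟨0, fun s hs => hs.1⟩
  have hne : ∀ τ, 0 ≤ τ → (A τ).Nonempty := fun τ hτ =>
    ⟨τ, hτ, by linarith [hnonneg τ hτ]⟩
  refine ⟨fun τ => sInf (A τ), fun τ hτ => le_csInf (hne τ hτ) fun s hs => hs.1, ?_, ?_,
    fun s τ hs hτ => csInf_le (hbdd τ) ⟨hs, hτ⟩⟩
  · intro a _ b hb hab
    exact csInf_le_csInf (hbdd a) (hne b hb) fun s hs => ⟨hs.1, hab.trans hs.2⟩
  · refine Filter.tendsto_atTop.2 fun M => ?_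
    set N := max M 0
    have hN0 : 0 ≤ N := le_max_right _ _
    filter_upwards [Filter.eventually_gt_atTop (N + φ N)] with τ hτ
    have hτ0 : 0 ≤ τ := by linarith [hnonneg N hN0]
    refine (le_max_left M 0).trans (le_csInf (hne τ hτ0) fun s hs => ?_)
    by_contra! hlt
    have := hmono hs.1 hN0 hlt.le
    linarith [hs.2]

/-- Reparametrizing the time argument of a class `KL` function preserves class `KL`. -/
theorem ClassKL.comp_time {β : ℝ → ℝ → ℝ} (hβ : ClassKL β) {σ : ℝ → ℝ}
    (hσ0 : ∀ τ, 0 ≤ τ → 0 ≤ σ τ) (hσ : MonotoneOn σ (Set.Ici 0))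
    (hlim : Filter.Tendsto σ Filter.atTop Filter.atTop) :
    ClassKL fun r τ => β r (σ τ) :=
  ⟨fun τ hτ => hβ.1 (σ τ) (hσ0 τ hτ), fun r hr =>
    ⟨fun a ha b hb hab => (hβ.2 r hr).1 (hσ0 a ha) (hσ0 b hb) (hσ ha hb hab),
      (hβ.2 r hr).2.comp hlim⟩⟩

theorem nJumps_self (γ : Set ℝ) (t : ℝ) : nJumps γ t t = 0 := by
  simp [nJumps]

/-- Proposition 1: under UIB, strong and weak `(h⁰,h)`-ISS are equivalent. -/
theorem stmt0 {n m : ℕ} {Λ : Type*} (γ : Λ → Set ℝ)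
    (f g : Λ → ℝ → Stt n → Stt m → Stt n)
    (hγ : ∀ l : Λ, IsImpulseSeq (γ l))
    (h0 h : ℝ → Stt n → ℝ)
    (hh0 : ∀ (t : ℝ) (ξ : Stt n), 0 ≤ t → 0 ≤ h0 t ξ)
    (hh : ∀ (t : ℝ) (ξ : Stt n), 0 ≤ t → 0 ≤ h t ξ)
    (huib : UIB (Set.range γ)) :
    StronglyISS γ f g h0 h ↔ WeaklyISS γ f g h0 h := by
  constructor
  · rintro ⟨β, ρ, hβ, hρ, hbound⟩
    refine ⟨β, ρ, hβ, hρ, fun l t0 x0 u T x ht0 hu hx t ht htT => ?_⟩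
    refine (hbound l t0 x0 u T x ht0 hu hx t ht htT).trans (add_le_add_left ?_ _)
    have hs : 0 ≤ t - t0 := sub_nonneg.2 ht
    have hn : (0 : ℝ) ≤ nJumps (γ l) t0 t := Nat.cast_nonneg _
    exact (hβ.2 _ (hh0 t0 x0 ht0)).1 hs (add_nonneg hs hn) (le_add_of_nonneg_right hn)
  · rintro ⟨β, ρ, hβ, hρ, hbound⟩
    obtain ⟨φ, -, hmono, hnonneg, hjumps⟩ := huib
    obtain ⟨σ, hσ0, hσ, hlim, hle⟩ := exists_time_rescaling hmono hnonneg
    refine ⟨fun r τ => β r (σ τ), ρ, hβ.comp_time hσ0 hσ hlim, hρ,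
      fun l t0 x0 u T x ht0 hu hx t ht htT => ?_⟩
    refine (hbound l t0 x0 u T x ht0 hu hx t ht htT).trans (add_le_add_left ?_ _)
    have hs : 0 ≤ t - t0 := sub_nonneg.2 ht
    have hn : (0 : ℝ) ≤ nJumps (γ l) t0 t := Nat.cast_nonneg _
    have hcount : (nJumps (γ l) t0 t : ℝ) ≤ φ (t - t0) := by
      rcases ht.eq_or_lt with rfl | hlt
      · simpa [nJumps_self] using hnonneg 0 le_rfl
      · exact hjumps _ (Set.mem_range_self l) t0 t ht0 hlt
    exact (hβ.2 _ (hh0 t0 x0 ht0)).1 (hσ0 _ (add_nonneg hs hn)) hs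
      (hle _ _ hs (by linarith))

end
end

section
/- Let Σ_Λ = {Σ_λ = (γ_λ,f_λ,g_λ)}_{λ∈Λ} be a parametrized family of impulsive systems with inputs, let h⁰, h ∈ H, and let Assumption 1 hold. If the parametrized family of comparison systems is weakly GUAS, then Σ_Λ is weakly (h⁰,h)-ISS. -/
open MeasureTheory Filter Set
open scoped Classical

noncomputable section

namespace ClassKInf

variable {α α₁ α₂ : ℝ → ℝ}

lemma mono (h : ClassKInf α) {r s : ℝ} (hr : 0 ≤ r) (hrs : r ≤ s) : α r ≤ α s :=
  h.2.1.monotoneOn hr (hr.trans hrs) hrs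

lemma nonneg (h : ClassKInf α) {r : ℝ} (hr : 0 ≤ r) : 0 ≤ α r :=
  h.2.2.1 ▸ h.mono le_rfl hr

lemma comp (h₁ : ClassKInf α₁) (h₂ : ClassKInf α₂) : ClassKInf fun r => α₁ (α₂ r) := by
  have hmaps : MapsTo α₂ (Ici 0) (Ici 0) := fun r hr => h₂.nonneg hr
  refine ⟨h₁.1.comp h₂.1 hmaps, fun a ha b hb hab => h₁.2.1 (hmaps ha) (hmaps hb)
    (h₂.2.1 ha hb hab), by simp [h₂.2.2.1, h₁.2.2.1], fun M => ?_⟩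
  obtain ⟨s, hs, hM⟩ := h₁.2.2.2 M
  obtain ⟨r, hr, hsr⟩ := h₂.2.2.2 s
  exact ⟨r, hr, hM.trans (h₁.mono hs hsr)⟩

lemma add (h₁ : ClassKInf α₁) (h₂ : ClassKInf α₂) : ClassKInf fun r => α₁ r + α₂ r := by
  refine ⟨h₁.1.add h₂.1, fun a ha b hb hab => add_lt_add (h₁.2.1 ha hb hab) (h₂.2.1 ha hb hab),
    by simp [h₁.2.2.1, h₂.2.2.1], fun M => ?_⟩
  obtain ⟨r, hr, hM⟩ := h₁.2.2.2 M
  exact ⟨r, hr, by linarith [h₂.nonneg hr]⟩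

lemma exists_leftInverse (h : ClassKInf α) :
    ∃ α' : ℝ → ℝ, ClassKInf α' ∧ ∀ r : ℝ, 0 ≤ r → α' (α r) = r := by
  let F : Ici (0 : ℝ) → Ici (0 : ℝ) := fun r => ⟨α r, h.nonneg r.2⟩
  have hF : StrictMono F := fun a b hab => h.2.1 a.2 b.2 hab
  have hsurj : Function.Surjective F := by
    rintro ⟨y, hy⟩
    obtain ⟨r, hr, hyr⟩ := h.2.2.2 y
    obtain ⟨s, hs, hsy⟩ := intermediate_value_Icc hr (h.1.mono Icc_subset_Ici_self)
      (⟨h.2.2.1.trans_le hy, hyr⟩ : y ∈ Icc (α 0) (α r))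
    exact ⟨⟨s, hs.1⟩, Subtype.ext hsy⟩
  let e := hF.orderIsoOfSurjective F hsurj
  have hinv : ∀ r : ℝ, ∀ hr : 0 ≤ r, (e.symm (projIci 0 (α r)) : ℝ) = r := fun r hr => by
    have : projIci 0 (α r) = e ⟨r, hr⟩ := projIci_of_mem (h.nonneg hr)
    rw [this, e.symm_apply_apply]
  have hproj : Continuous (projIci (0 : ℝ)) :=
    (continuous_const.max continuous_id).subtype_mk _
  refine ⟨fun y => e.symm (projIci 0 y), ⟨?_, ?_, ?_, fun M => ?_⟩, hinv⟩
  · exact (continuous_subtype_val.comp (e.symm.continuous.comp hproj)).continuousOn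
  · intro a ha b hb hab
    exact e.symm.strictMono (strictMonoOn_projIci ha hb hab)
  · simpa [h.2.2.1] using hinv 0 le_rfl
  · refine ⟨α (max M 0), h.nonneg (le_max_right _ _), ?_⟩
    exact (le_max_left M 0).trans_eq (hinv _ (le_max_right _ _)).symm

end ClassKInf

lemma ClassKL.comp_comp {β : ℝ → ℝ → ℝ} {α₁ α₂ : ℝ → ℝ} (hβ : ClassKL β) (h₁ : ClassKInf α₁)
    (h₂ : ClassKInf α₂) : ClassKL fun r t => α₁ (β (α₂ r) t) := by
  have hnn : ∀ r t : ℝ, 0 ≤ r → 0 ≤ t → 0 ≤ β (α₂ r) t :=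
    fun r t hr ht => (hβ.1 t ht).nonneg (h₂.nonneg hr)
  refine ⟨fun t ht => h₁.comp ((hβ.1 t ht).comp h₂), fun r hr => ⟨fun s hs t ht hst => ?_, ?_⟩⟩
  · exact h₁.mono (hnn r t hr ht) ((hβ.2 _ (h₂.nonneg hr)).1 hs ht hst)
  · have hz : Tendsto (fun t => β (α₂ r) t) atTop (nhdsWithin 0 (Ici 0)) :=
      tendsto_nhdsWithin_iff.2 ⟨(hβ.2 _ (h₂.nonneg hr)).2,
        (eventually_ge_atTop 0).mono fun t ht => hnn r t hr ht⟩
    have := (h₁.1 0 self_mem_Ici).tendsto.comp hz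
    rwa [h₁.2.2.1] at this

lemma IsImpulseSeq.exists_punctured_ball {γ : Set ℝ} (hγ : IsImpulseSeq γ) (a : ℝ) :
    ∃ ε > 0, ∀ s : ℝ, |s - a| < ε → s ≠ a → s ∉ γ := by
  have hfin : ((γ ∩ Iic (a + 1)) \ {a}).Finite := (hγ.2 (a + 1)).sdiff
  obtain ⟨ε, hε, hball⟩ := Metric.mem_nhds_iff.1
    (hfin.isClosed.isOpen_compl.mem_nhds (by simp : a ∈ ((γ ∩ Iic (a + 1)) \ {a})ᶜ))
  refine ⟨min ε 1, by positivity, fun s hs hne hsγ => ?_⟩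
  have h1 : s ∈ Metric.ball a ε := by
    rw [Metric.mem_ball, Real.dist_eq]
    exact hs.trans_le (min_le_left _ _)
  have h2 : s ≤ a + 1 := by linarith [(abs_lt.1 (hs.trans_le (min_le_right _ _))).2]
  exact hball h1 ⟨⟨hsγ, h2⟩, hne⟩

lemma IsImpulseSeq.exists_gt_Ioo_inter_eq_empty {γ : Set ℝ} (hγ : IsImpulseSeq γ) {a b : ℝ}
    (h : Ioc a b ∩ γ = ∅) : ∃ c > b, Ioo a c ∩ γ = ∅ := by
  obtain ⟨ε, hε, hne⟩ := hγ.exists_punctured_ball b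
  refine ⟨b + ε, lt_add_of_pos_right b hε, eq_empty_of_forall_notMem fun s hs => ?_⟩
  rcases le_or_gt s b with hsb | hsb
  · exact eq_empty_iff_forall_notMem.1 h s ⟨⟨hs.1.1, hsb⟩, hs.2⟩
  · exact hne s (abs_lt.2 ⟨by linarith, by linarith [hs.1.2]⟩) hsb.ne' hs.2

/-- `z` is absolutely continuous on `[t1, t2]` and satisfies `ż ≤ -φ(t, z)` almost everywhere
there. -/
def FlowOn (φ : ℝ → ℝ → ℝ) (z : ℝ → ℝ) (t1 t2 : ℝ) : Prop :=
  ∃ d : ℝ → ℝ, IntegrableOn d (Icc t1 t2) ∧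
    (∀ᵐ s ∂volume, s ∈ Icc t1 t2 → d s ≤ -φ s (z s)) ∧
    ∀ t ∈ Icc t1 t2, z t = z t1 + ∫ s in t1..t, d s

namespace FlowOn

variable {φ : ℝ → ℝ → ℝ} {z z' : ℝ → ℝ} {a b c : ℝ}

lemma congr (h : FlowOn φ z a b) (hzz' : EqOn z z' (Icc a b)) : FlowOn φ z' a b := by
  obtain ⟨d, hd, hle, heq⟩ := h
  refine ⟨d, hd, ?_, fun t ht => ?_⟩
  · filter_upwards [hle] with s hs hsI
    rw [← hzz' hsI]
    exact hs hsI
  · rw [← hzz' ht, ← hzz' ⟨le_rfl, ht.1.trans ht.2⟩]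
    exact heq t ht

lemma trans (hab : a ≤ b) (hbc : b ≤ c) (h₁ : FlowOn φ z a b) (h₂ : FlowOn φ z b c) :
    FlowOn φ z a c := by
  obtain ⟨d₁, hd₁, hle₁, heq₁⟩ := h₁
  obtain ⟨d₂, hd₂, hle₂, heq₂⟩ := h₂
  let d : ℝ → ℝ := fun s => if s ≤ b then d₁ s else d₂ s
  have e₁ : ∀ s ∈ Icc a b, d₁ s = d s := fun s hs => (if_pos hs.2).symm
  have e₂ : ∀ s ∈ Ioc b c, d₂ s = d s := fun s hs => (if_neg hs.1.not_ge).symm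
  have i₁ : IntegrableOn d (Icc a b) := hd₁.congr_fun e₁ measurableSet_Icc
  have i₂ : IntegrableOn d (Ioc b c) :=
    (hd₂.mono_set Ioc_subset_Icc_self).congr_fun e₂ measurableSet_Ioc
  have hd : IntegrableOn d (Icc a c) := by
    rw [← Icc_union_Ioc_eq_Icc hab hbc]
    exact i₁.union i₂
  have ii : ∀ t1 t2, a ≤ t1 → t1 ≤ t2 → t2 ≤ c → IntervalIntegrable d volume t1 t2 :=
    fun t1 t2 h1 h12 h2 => (intervalIntegrable_iff_integrableOn_Icc_of_le h12).2
      (hd.mono_set (Icc_subset_Icc h1 h2))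
  have ha : ∀ t ∈ Icc a b, z t = z a + ∫ s in a..t, d s := fun t ht => by
    rw [heq₁ t ht]
    congr 1
    refine intervalIntegral.integral_congr fun s hs => e₁ s ?_
    rw [uIcc_of_le ht.1] at hs
    exact ⟨hs.1, hs.2.trans ht.2⟩
  refine ⟨d, hd, ?_, fun t ht => ?_⟩
  · filter_upwards [hle₁, hle₂] with s hs₁ hs₂ hsI
    by_cases hsb : s ≤ b
    · simpa only [d, if_pos hsb] using hs₁ ⟨hsI.1, hsb⟩
    · simpa only [d, if_neg hsb] using hs₂ ⟨(not_le.1 hsb).le, hsI.2⟩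
  · rcases le_total t b with htb | htb
    · exact ha t ⟨ht.1, htb⟩
    · rw [heq₂ t ⟨htb, ht.2⟩, ha b ⟨hab, le_rfl⟩, add_assoc,
        ← intervalIntegral.integral_add_adjacent_intervals (ii a b le_rfl hab hbc)
          (ii b t hab htb ht.2)]
      congr 2
      refine intervalIntegral.integral_congr_ae (ae_of_all _ fun s hs => e₂ s ?_)
      rw [uIoc_of_le htb] at hs
      exact ⟨hs.1, hs.2.trans ht.2⟩

lemma of_eq_sub_integral {m : ℝ → ℝ} {C p q r : ℝ} (hm : IntegrableOn m (Icc p q))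
    (hr : r ∈ Icc p q) (hpa : p ≤ a) (hbq : b ≤ q) (hφ : ∀ s ∈ Icc a b, |φ s (z s)| ≤ m s)
    (hz : ∀ s ∈ Icc a b, z s = C - ∫ τ in r..s, m τ) : FlowOn φ z a b := by
  have ii : ∀ t1 ∈ Icc p q, ∀ t2 ∈ Icc p q, IntervalIntegrable m volume t1 t2 :=
    fun t1 h1 t2 h2 => (hm.mono_set (uIcc_subset_Icc h1 h2)).intervalIntegrable
  refine ⟨fun s => -m s, (hm.mono_set (Icc_subset_Icc hpa hbq)).neg, ae_of_all _ fun s hs => ?_,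
    fun t ht => ?_⟩
  · linarith [le_abs_self (φ s (z s)), hφ s hs]
  · have hab := ht.1.trans ht.2
    rw [hz t ht, hz a ⟨le_rfl, hab⟩, intervalIntegral.integral_neg,
      ← intervalIntegral.integral_add_adjacent_intervals (ii r hr a ⟨hpa, hab.trans hbq⟩)
        (ii a ⟨hpa, hab.trans hbq⟩ t ⟨hpa.trans ht.1, ht.2.trans hbq⟩)]
    ring

end FlowOn

/-- Solutions of the comparison inclusion on a compact interval `[a, b]`. -/
structure CompSolOn (γ : Set ℝ) (φ al : ℝ → ℝ → ℝ) (a b : ℝ) (z : ℝ → ℝ) : Prop where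
  nonneg : ∀ s ∈ Icc a b, 0 ≤ z s
  flow : ∀ t1 t2 : ℝ, a ≤ t1 → t1 ≤ t2 → t2 ≤ b → Ioc t1 t2 ∩ γ = ∅ → FlowOn φ z t1 t2
  jump : ∀ t ∈ γ, a < t → t ≤ b →
    ∃ L : ℝ, Tendsto z (nhdsWithin t (Iio t)) (nhds L) ∧ z t ≤ al t L

/-- The bound `β` holds for all solutions of the comparison inclusion. -/
def CompBound (γ : Set ℝ) (φ al β : ℝ → ℝ → ℝ) : Prop :=
  ∀ (t0 z0 : ℝ) (T : EReal) (z : ℝ → ℝ), 0 ≤ t0 → 0 ≤ z0 → IsCompSol γ φ al t0 z0 T z →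
    ∀ t : ℝ, t0 ≤ t → (t : EReal) < T → z t ≤ β z0 (t - t0)

namespace CompSolOn

variable {γ : Set ℝ} {φ al β : ℝ → ℝ → ℝ} {a b c : ℝ} {z : ℝ → ℝ}

lemma le_of_compBound (hγ : IsImpulseSeq γ) (hφ : Caratheodory2 φ) (hβ : ClassKL β)
    (hB : CompBound γ φ al β) (ha : 0 ≤ a) (hab : a ≤ b) (hz : CompSolOn γ φ al a b z) :
    z b ≤ β (z a) (b - a) := by
  have hza := hz.nonneg a ⟨le_rfl, hab⟩
  rcases (hz.nonneg b ⟨hab, le_rfl⟩).eq_or_lt with h0 | hpos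
  · rw [← h0]
    exact (hβ.1 _ (sub_nonneg.2 hab)).nonneg hza
  obtain ⟨m, hm, hφm⟩ := hφ.2.2 b (b + 1) (z b)
  have hm0 : ∀ s ∈ Icc b (b + 1), 0 ≤ m s := fun s hs =>
    (abs_nonneg _).trans (hφm s hs 0 ⟨le_rfl, hpos.le⟩)
  have hcont : ContinuousOn (fun s => ∫ τ in b..s, m τ) (Icc b (b + 1)) :=
    uIcc_of_le (le_add_of_nonneg_right zero_le_one : b ≤ b + 1) ▸
      intervalIntegral.continuousOn_primitive_interval
        (by rwa [uIcc_of_le (le_add_of_nonneg_right zero_le_one)])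
  have hev : ∀ᶠ s in nhdsWithin b (Icc b (b + 1)), ∫ τ in b..s, m τ < z b :=
    (hcont b ⟨le_rfl, by linarith⟩).tendsto.eventually_lt_const (by simpa using hpos)
  obtain ⟨δ, hδ, hsmall⟩ := Metric.mem_nhdsWithin_iff.1 hev
  obtain ⟨η, hη, hfree⟩ := hγ.exists_punctured_ball b
  let e := min (min δ η) 1
  have he : 0 < e := by positivity
  have heδ : e ≤ δ := (min_le_left _ _).trans (min_le_left _ _)
  have heη : e ≤ η := (min_le_left _ _).trans (min_le_right _ _)
  have he1 : e ≤ 1 := min_le_right _ _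
  let w : ℝ → ℝ := fun s => if s ≤ b then z s else z b - ∫ τ in b..s, m τ
  have hw₁ : ∀ s ≤ b, w s = z s := fun s hs => if_pos hs
  have hw₂ : ∀ s, b ≤ s → w s = z b - ∫ τ in b..s, m τ := fun s hs => by
    rcases hs.eq_or_lt with rfl | hs
    · simp [w]
    · exact if_neg hs.not_ge
  have hrange : ∀ s, b ≤ s → s < b + e → w s ∈ Icc 0 (z b) := fun s hs hse => by
    have hlt : ∫ τ in b..s, m τ < z b := hsmall ⟨by
      rw [Metric.mem_ball, Real.dist_eq, abs_lt]; constructor <;> linarith, hs, by linarith⟩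
    have hge : 0 ≤ ∫ τ in b..s, m τ :=
      intervalIntegral.integral_nonneg hs fun τ hτ => hm0 τ ⟨hτ.1, by linarith [hτ.2]⟩
    rw [hw₂ s hs]
    exact ⟨by linarith, by linarith⟩
  have hsol : IsCompSol γ φ al a (z a) ((b + e : ℝ) : EReal) w := by
    refine ⟨by exact_mod_cast (by linarith : a < b + e), hw₁ a hab, fun t hat ht => ?_,
      fun t1 t2 h1 h12 h2 hemp => ?_, fun t htγ hat ht => ?_⟩
    · rcases le_total t b with htb | htb
      · rw [hw₁ t htb]; exact hz.nonneg t ⟨hat, htb⟩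
      · exact (hrange t htb (by exact_mod_cast ht)).1
    · replace h2 : t2 < b + e := by exact_mod_cast h2
      have hleft : ∀ t, t1 ≤ t → t ≤ b → t ≤ t2 → FlowOn φ w t1 t := fun t h1t htb ht2 =>
        (hz.flow t1 t h1 h1t htb (subset_empty_iff.1 (hemp ▸
          inter_subset_inter_left _ (Ioc_subset_Ioc_right ht2)))).congr
          fun s hs => (hw₁ s (hs.2.trans htb)).symm
      have hright : ∀ t, b ≤ t → FlowOn φ w t t2 := fun t hbt =>
        FlowOn.of_eq_sub_integral (r := b) hm ⟨le_rfl, by linarith⟩ hbt (by linarith)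
          (fun s hs => hφm s ⟨hbt.trans hs.1, by linarith [hs.2]⟩ _
            (hrange s (hbt.trans hs.1) (by linarith [hs.2])))
          (fun s hs => hw₂ s (hbt.trans hs.1))
      rcases le_total t2 b with h2b | h2b
      · exact hleft t2 h12 h2b le_rfl
      · rcases le_total b t1 with h1b | h1b
        · exact hright t1 h1b
        · exact (hleft b h1b le_rfl h2b).trans h1b h2b (hright b le_rfl)
    · replace ht : t < b + e := by exact_mod_cast ht
      have htb : t ≤ b := by
        by_contra! hbt
        exact hfree t (by rw [abs_lt]; constructor <;> linarith) hbt.ne' htγ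
      obtain ⟨L, hL, hle⟩ := hz.jump t htγ hat htb
      refine ⟨L, hL.congr' ?_, by rwa [hw₁ t htb]⟩
      filter_upwards [self_mem_nhdsWithin] with s hs
      exact (hw₁ s (le_of_lt (lt_of_lt_of_le hs htb))).symm
  have := hB a (z a) _ w ha hza hsol b hab (by exact_mod_cast (by linarith : b < b + e))
  rwa [hw₁ b le_rfl] at this

lemma le_of_compBound_of_jump (hγ : IsImpulseSeq γ) (hφ : Caratheodory2 φ) (hβ : ClassKL β)
    (hB : CompBound γ φ al β) (ha : a ∈ γ) (hab : a ≤ b) (hz : CompSolOn γ φ al a b z)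
    (hc : 0 ≤ c) (hac : z a ≤ al a c) : z b ≤ β c 0 := by
  have ha0 : 0 < a := hγ.1 ha
  suffices hδ : ∀ δ > 0, z b ≤ β (c + δ) 0 by
    have hcont : ContinuousWithinAt (fun r => β r 0) (Ici 0) c := (hβ.1 0 le_rfl).1 c hc
    have hlim : Tendsto (fun δ : ℝ => c + δ) (nhdsWithin 0 (Ioi 0)) (nhdsWithin c (Ici 0)) := by
      refine tendsto_nhdsWithin_iff.2 ⟨?_, ?_⟩
      · have : Tendsto (fun δ : ℝ => c + δ) (nhds 0) (nhds (c + 0)) :=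
          (continuous_const.add continuous_id).tendsto 0
        rw [add_zero] at this
        exact this.mono_left nhdsWithin_le_nhds
      · filter_upwards [self_mem_nhdsWithin] with δ hδ
        exact add_nonneg hc (le_of_lt hδ)
    refine ge_of_tendsto (hcont.tendsto.comp hlim) ?_
    filter_upwards [self_mem_nhdsWithin] with δ hδ'
    exact hδ δ hδ'
  intro δ hδ
  obtain ⟨m, hm, hφm⟩ := hφ.2.2 0 a (c + δ)
  have hm0 : ∀ s ∈ Icc 0 a, 0 ≤ m s := fun s hs =>
    (abs_nonneg _).trans (hφm s hs 0 ⟨le_rfl, by linarith⟩)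
  have hcont : ContinuousOn (fun s => ∫ τ in a..s, m τ) (Icc 0 a) :=
    intervalIntegral.continuousOn_primitive_interval' (b₁ := 0) (b₂ := a)
      ((intervalIntegrable_iff_integrableOn_Icc_of_le ha0.le).2 hm) right_mem_uIcc
      |>.mono (by rw [uIcc_of_le ha0.le])
  have hcont_a : Tendsto (fun s => ∫ τ in a..s, m τ) (nhdsWithin a (Icc 0 a)) (nhds 0) := by
    simpa using (hcont a ⟨ha0.le, le_rfl⟩).tendsto
  obtain ⟨ε, hε, hsmall⟩ := Metric.mem_nhdsWithin_iff.1
    (hcont_a.eventually_const_lt (neg_neg_of_pos hδ))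
  obtain ⟨η, hη, hfree⟩ := hγ.exists_punctured_ball a
  let e := min (min ε η) a / 2
  have hmin : 0 < min (min ε η) a := by positivity
  have he : 0 < e := by positivity
  have heε : e < ε := (half_lt_self hmin).trans_le ((min_le_left _ _).trans (min_le_left _ _))
  have heη : e < η := (half_lt_self hmin).trans_le ((min_le_left _ _).trans (min_le_right _ _))
  have hea : e < a := (half_lt_self hmin).trans_le (min_le_right _ _)
  let w : ℝ → ℝ := fun s => if s < a then c - ∫ τ in a..s, m τ else z s
  have hw₁ : ∀ s < a, w s = c - ∫ τ in a..s, m τ := fun s hs => if_pos hs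
  have hw₂ : ∀ s, a ≤ s → w s = z s := fun s hs => if_neg hs.not_gt
  have hrange : ∀ s, a - e ≤ s → s < a → w s ∈ Icc 0 (c + δ) := fun s hs hsa => by
    have hlt : -δ < ∫ τ in a..s, m τ := hsmall ⟨by
      rw [Metric.mem_ball, Real.dist_eq, abs_lt]; constructor <;> linarith, by linarith, hsa.le⟩
    have hge : 0 ≤ ∫ τ in s..a, m τ :=
      intervalIntegral.integral_nonneg hsa.le fun τ hτ => hm0 τ ⟨by linarith [hτ.1], hτ.2⟩
    rw [intervalIntegral.integral_symm] at hge
    rw [hw₁ s hsa]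
    exact ⟨by linarith, by linarith⟩
  have hsol : CompSolOn γ φ al (a - e) b w := by
    refine ⟨fun s hs => ?_, fun t1 t2 h1 h12 h2 hemp => ?_, fun t htγ hat ht => ?_⟩
    · rcases lt_or_ge s a with hsa | hsa
      · exact (hrange s hs.1 hsa).1
      · rw [hw₂ s hsa]; exact hz.nonneg s ⟨hsa, hs.2⟩
    · rcases lt_or_ge t2 a with h2a | h2a
      · exact FlowOn.of_eq_sub_integral (r := a) (p := 0) (q := a) hm ⟨ha0.le, le_rfl⟩
          (by linarith) h2a.le
          (fun s hs => hφm s ⟨by linarith [hs.1], by linarith [hs.2]⟩ _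
            (hrange s (h1.trans hs.1) (hs.2.trans_lt h2a)))
          (fun s hs => hw₁ s (hs.2.trans_lt h2a))
      · have h1a : a ≤ t1 := by
          by_contra! h1a
          exact (hemp ▸ (⟨⟨h1a, h2a⟩, ha⟩ : a ∈ Ioc t1 t2 ∩ γ) : a ∈ (∅ : Set ℝ))
        exact (hz.flow t1 t2 h1a h12 h2 hemp).congr fun s hs => (hw₂ s (h1a.trans hs.1)).symm
    · rcases lt_trichotomy t a with hta | rfl | hta
      · exact absurd htγ (hfree t (by rw [abs_lt]; constructor <;> linarith) hta.ne)
      · refine ⟨c, ?_, by rwa [hw₂ t le_rfl]⟩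
        have hlim : Tendsto (fun s => ∫ τ in t..s, m τ) (nhdsWithin t (Iio t)) (nhds 0) := by
          rw [← nhdsWithin_Ico_eq_nhdsLT ha0]
          exact hcont_a.mono_left (nhdsWithin_mono _ Ico_subset_Icc_self)
        have := hlim.const_sub c
        rw [sub_zero] at this
        refine this.congr' ?_
        filter_upwards [self_mem_nhdsWithin] with s hs
        exact (hw₁ s hs).symm
      · obtain ⟨L, hL, hle⟩ := hz.jump t htγ hta ht
        refine ⟨L, hL.congr' ?_, by rwa [hw₂ t hta.le]⟩
        filter_upwards [Ioo_mem_nhdsLT hta] with s hs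
        exact (hw₂ s hs.1.le).symm
  have hle := hsol.le_of_compBound hγ hφ hβ hB (by linarith) (by linarith)
  have hr := hrange (a - e) le_rfl (by linarith)
  have hpos : 0 ≤ b - (a - e) := by linarith
  rw [hw₂ b hab] at hle
  calc z b ≤ β (w (a - e)) (b - (a - e)) := hle
    _ ≤ β (w (a - e)) 0 := (hβ.2 _ hr.1).1 self_mem_Ici hpos hpos
    _ ≤ β (c + δ) 0 := (hβ.1 0 le_rfl).mono hr.1 hr.2

end CompSolOn

/-- Before the last time at which `v` is at most `c` nothing is assumed; afterwards `v` solves the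
comparison inclusion, and the impulse at that time either starts a comparison trajectory from a
left limit at most `c`, or resets `v` below `p`. -/
lemma le_of_compBound_of_threshold {γ : Set ℝ} {φ al β : ℝ → ℝ → ℝ} {a b c p : ℝ} {v : ℝ → ℝ}
    (hγ : IsImpulseSeq γ) (hφ : Caratheodory2 φ) (hβ : ClassKL β) (hB : CompBound γ φ al β)
    (ha : 0 ≤ a) (hab : a ≤ b) (hv : ∀ s ∈ Icc a b, 0 ≤ v s)
    (hcont : ∀ t1 t2 : ℝ, a ≤ t1 → t1 ≤ t2 → t2 ≤ b → Ioc t1 t2 ∩ γ = ∅ →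
      ContinuousOn v (Icc t1 t2))
    (hflow : ∀ t1 t2 : ℝ, a ≤ t1 → t1 ≤ t2 → t2 ≤ b → Ioc t1 t2 ∩ γ = ∅ →
      (∀ s ∈ Ioc t1 t2, c ≤ v s) → FlowOn φ v t1 t2)
    (hjump : ∀ t ∈ γ, a < t → t ≤ b →
      ∃ L : ℝ, Tendsto v (nhdsWithin t (Iio t)) (nhds L) ∧ (c ≤ L → v t ≤ al t L) ∧
        (L ≤ c → v t ≤ al t L ∨ v t ≤ p)) :
    v b ≤ β (v a) (b - a) ∨ v b ≤ c ∨ v b ≤ β c 0 ∨ v b ≤ β p 0 := by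
  have hsol : ∀ s, a ≤ s → s ≤ b → (∀ t ∈ Ioc s b, c < v t) → CompSolOn γ φ al s b v := by
    intro s has hsb hgt
    refine ⟨fun t ht => hv t ⟨has.trans ht.1, ht.2⟩, fun t1 t2 h1 h12 h2 hemp =>
      hflow t1 t2 (has.trans h1) h12 h2 hemp fun t ht =>
        (hgt t ⟨h1.trans_lt ht.1, ht.2.trans h2⟩).le, fun t htγ hst htb => ?_⟩
    obtain ⟨L, hL, hle, -⟩ := hjump t htγ (has.trans_lt hst) htb
    refine ⟨L, hL, hle (ge_of_tendsto hL ?_)⟩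
    filter_upwards [Ioo_mem_nhdsLT hst] with τ hτ
    exact (hgt τ ⟨hτ.1, hτ.2.le.trans htb⟩).le
  have hzero : ∀ s, a ≤ s → s ≤ b → CompSolOn γ φ al s b v → v b ≤ β (v s) 0 :=
    fun s has hsb h => (h.le_of_compBound hγ hφ hβ hB (ha.trans has) hsb).trans
      ((hβ.2 _ (hv s ⟨has, hsb⟩)).1 self_mem_Ici (sub_nonneg.2 hsb : b - s ∈ Ici 0)
        (sub_nonneg.2 hsb))
  have hmono : ∀ {r q : ℝ}, 0 ≤ r → r ≤ q → β r 0 ≤ β q 0 := (hβ.1 0 le_rfl).mono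
  let S : Set ℝ := {s | s ∈ Icc a b ∧ v s ≤ c}
  rcases S.eq_empty_or_nonempty with hS | hS
  · refine Or.inl ((hsol a le_rfl hab fun t ht => ?_).le_of_compBound hγ hφ hβ hB ha hab)
    by_contra! hle
    exact (hS ▸ (⟨⟨ht.1.le, ht.2⟩, hle⟩ : t ∈ S) : t ∈ (∅ : Set ℝ))
  have hbdd : BddAbove S := ⟨b, fun s hs => hs.1.2⟩
  have hlub := isLUB_csSup hS hbdd
  set σ := sSup S with hσ
  obtain ⟨s₀, hs₀⟩ := hS
  have haσ : a ≤ σ := hs₀.1.1.trans (hlub.1 hs₀)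
  have hσb : σ ≤ b := hlub.2 fun s hs => hs.1.2
  have hafter : ∀ t ∈ Ioc σ b, c < v t := fun t ht => by
    by_contra! hle
    exact ht.1.not_ge (hlub.1 ⟨⟨haσ.trans ht.1.le, ht.2⟩, hle⟩)
  have hs := hsol σ haσ hσb hafter
  have hvσ := hv σ ⟨haσ, hσb⟩
  by_cases hσS : v σ ≤ c
  · exact Or.inr (Or.inr (Or.inl ((hzero σ haσ hσb hs).trans (hmono hvσ hσS))))
  have hfreq : ∃ᶠ s in nhdsWithin σ (Iio σ), v s ≤ c := by
    rw [Filter.frequently_iff]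
    intro U hU
    obtain ⟨l, hl, hlU⟩ := (mem_nhdsLT_iff_exists_Ioo_subset' (sub_one_lt σ)).1 hU
    obtain ⟨s, hsS, hls⟩ := (lt_isLUB_iff hlub).1 hl
    have hne : s ≠ σ := fun h => hσS (h ▸ hsS.2)
    exact ⟨s, hlU ⟨hls, lt_of_le_of_ne (hlub.1 hsS) hne⟩, hsS.2⟩
  have haσ' : a < σ := lt_of_le_of_ne haσ fun h => hσS (by
    have : s₀ = σ := le_antisymm (hlub.1 hs₀) (h ▸ hs₀.1.1)
    exact this ▸ hs₀.2)
  by_cases hσγ : σ ∈ γ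
  · obtain ⟨L, hL, -, hle⟩ := hjump σ hσγ haσ' hσb
    have hLc : L ≤ c := le_of_tendsto_of_frequently hL hfreq
    have hL0 : 0 ≤ L := by
      refine ge_of_tendsto hL ?_
      filter_upwards [Ioo_mem_nhdsLT haσ'] with s hs
      exact hv s ⟨hs.1.le, hs.2.le.trans hσb⟩
    rcases hle hLc with h | h
    · exact Or.inr (Or.inr (Or.inl ((hs.le_of_compBound_of_jump hγ hφ hβ hB hσγ hσb hL0 h).trans
        (hmono hL0 hLc))))
    · exact Or.inr (Or.inr (Or.inr ((hzero σ haσ hσb hs).trans (hmono hvσ h))))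
  · obtain ⟨η, hη, hfree⟩ := hγ.exists_punctured_ball σ
    let s₁ := max a (σ - η / 2)
    have h₁ : s₁ < σ := max_lt haσ' (by linarith)
    have hemp : Ioc s₁ σ ∩ γ = ∅ := by
      ext s
      simp only [mem_inter_iff, mem_empty_iff_false, iff_false, not_and]
      intro hsI hsγ
      have hge : σ - η / 2 ≤ s₁ := le_max_right _ _
      rcases hsI.2.eq_or_lt with rfl | hlt
      · exact hσγ hsγ
      · exact hfree s (by rw [abs_lt]; constructor <;> linarith [hsI.1]) hlt.ne hsγ
    have hc := hcont s₁ σ (le_max_left _ _) h₁.le hσb hemp σ ⟨h₁.le, le_rfl⟩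
    have hlim : Tendsto v (nhdsWithin σ (Iio σ)) (nhds (v σ)) := by
      rw [← nhdsWithin_Ico_eq_nhdsLT h₁]
      exact hc.tendsto.mono_left (nhdsWithin_mono _ Ico_subset_Icc_self)
    exact absurd (le_of_tendsto_of_frequently hlim hfreq) hσS

lemma AbsolutelyContinuousOnInterval.of_dist_le_mul {X Y : Type*} [PseudoMetricSpace X]
    [PseudoMetricSpace Y] {v : ℝ → X} {G : ℝ → Y} {a b K : ℝ}
    (hG : AbsolutelyContinuousOnInterval G a b)
    (h : ∀ s ∈ uIcc a b, ∀ t ∈ uIcc a b, dist (v s) (v t) ≤ K * dist (G s) (G t)) :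
    AbsolutelyContinuousOnInterval v a b := by
  have hlim := Tendsto.const_mul K hG
  rw [mul_zero] at hlim
  refine squeeze_zero' (Eventually.of_forall fun E => Finset.sum_nonneg fun i _ => dist_nonneg)
    ?_ hlim
  filter_upwards [mem_inf_of_right (mem_principal_self _)] with E hE
  rw [Finset.mul_sum]
  exact Finset.sum_le_sum fun i hi => h _ (hE.1 i hi).1 _ (hE.1 i hi).2

section Trajectory

variable {n m : ℕ} {V : ℝ → Stt n → ℝ} {x F : ℝ → Stt n} {a b c : ℝ}

lemma absolutelyContinuousOnInterval_comp_trajectory (hab : a ≤ b) (hbc : b < c)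
    (hV : LocLipschitzOn (Ico a c ×ˢ (univ : Set (Stt n))) (fun q : ℝ × Stt n => V q.1 q.2))
    (hF : IntegrableOn F (Icc a b)) (hx : ∀ s ∈ Icc a b, x s = x a + ∫ τ in a..s, F τ) :
    AbsolutelyContinuousOnInterval (fun s => V s (x s)) a b := by
  have hFi : IntervalIntegrable F volume a b :=
    (intervalIntegrable_iff_integrableOn_Icc_of_le hab).2 hF
  have hxc : ContinuousOn x (Icc a b) := by
    refine ContinuousOn.congr ?_ hx
    refine continuousOn_const.add ?_
    have := intervalIntegral.continuousOn_primitive_interval' (b₁ := a) (b₂ := b) hFi left_mem_uIcc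
    rwa [uIcc_of_le hab] at this
  obtain ⟨K, hK⟩ := LocallyLipschitzOn.exists_lipschitzOnWith_of_compact
    (f := fun q : ℝ × Stt n => V q.1 q.2)
    (isCompact_Icc.image_of_continuousOn (continuousOn_id.prodMk hxc))
    (LocallyLipschitzOn.mono (t := Ico a c ×ˢ (univ : Set (Stt n))) (fun q hq => hV q hq) (by
      rintro _ ⟨s, hs, rfl⟩
      exact ⟨⟨hs.1, hs.2.trans_lt hbc⟩, mem_univ _⟩))
  have hFn : IntervalIntegrable (fun s => ‖F s‖) volume a b := hFi.norm
  let G : ℝ → ℝ := fun s => s + ∫ τ in a..s, ‖F τ‖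
  have hG : AbsolutelyContinuousOnInterval G a b :=
    (LipschitzWith.id.lipschitzOnWith.absolutelyContinuousOnInterval).add
      (hFn.absolutelyContinuousOnInterval_intervalIntegral left_mem_uIcc)
  refine hG.of_dist_le_mul (K := K) ?_
  have hord : ∀ s ∈ Icc a b, ∀ t ∈ Icc a b, s ≤ t →
      dist (V s (x s)) (V t (x t)) ≤ K * dist (G s) (G t) := by
    intro s hs t ht hst
    have has : IntervalIntegrable F volume a s := hFi.mono_set (by
      rw [uIcc_of_le hs.1, uIcc_of_le hab]; exact Icc_subset_Icc_right hs.2)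
    have hsti : IntervalIntegrable F volume s t := hFi.mono_set (by
      rw [uIcc_of_le hst, uIcc_of_le hab]; exact Icc_subset_Icc hs.1 ht.2)
    have hxd : dist (x s) (x t) ≤ ∫ τ in s..t, ‖F τ‖ := by
      rw [dist_comm, dist_eq_norm, hx s hs, hx t ht,
        ← intervalIntegral.integral_add_adjacent_intervals has hsti]
      simpa using intervalIntegral.norm_integral_le_integral_norm hst
    have hnn : 0 ≤ ∫ τ in s..t, ‖F τ‖ :=
      intervalIntegral.integral_nonneg hst fun _ _ => norm_nonneg _
    have hGd : dist (G s) (G t) = (t - s) + ∫ τ in s..t, ‖F τ‖ := by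
      simp only [G]
      rw [dist_comm, Real.dist_eq,
        ← intervalIntegral.integral_add_adjacent_intervals has.norm hsti.norm,
        show t + ((∫ τ in a..s, ‖F τ‖) + ∫ τ in s..t, ‖F τ‖) - (s + ∫ τ in a..s, ‖F τ‖) =
          (t - s) + ∫ τ in s..t, ‖F τ‖ by ring]
      exact abs_of_nonneg (add_nonneg (sub_nonneg.2 hst) hnn)
    refine (hK.dist_le_mul _ (mem_image_of_mem _ hs) _ (mem_image_of_mem _ ht)).trans ?_
    refine mul_le_mul_of_nonneg_left ?_ K.2
    rw [Prod.dist_eq, hGd]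
    refine max_le ?_ (by linarith)
    simp only [id]
    rw [dist_comm, Real.dist_eq, abs_of_nonneg (sub_nonneg.2 hst)]
    linarith
  rw [uIcc_of_le hab]
  intro s hs t ht
  rcases le_total s t with hst | hst
  · exact hord s hs t ht hst
  · rw [dist_comm, dist_comm (G s)]
    exact hord t ht s hs hst

lemma diniAlong_eq_of_hasDerivAt {f : ℝ → Stt n → Stt m → Stt n} {s v' : ℝ} {μ : Stt m}
    {W : Set (ℝ × Stt n)} {K : NNReal} (hW : W ∈ nhds (s, x s))
    (hV : LipschitzOnWith K (fun q : ℝ × Stt n => V q.1 q.2) W)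
    (hx : HasDerivAt x (f s (x s) μ) s) (hv : HasDerivAt (fun s => V s (x s)) v' s) :
    DiniAlong f V s (x s) μ = v' := by
  set y := f s (x s) μ
  have hv0 : Tendsto (fun d : ℝ => (V (s + d) (x (s + d)) - V s (x s)) / d)
      (nhdsWithin 0 (Ioi 0)) (nhds v') := by
    refine (hv.tendsto_slope_zero_right).congr fun d => ?_
    rw [smul_eq_mul, div_eq_inv_mul]
  have hx0 : Tendsto (fun d : ℝ => ‖d⁻¹ • (x (s + d) - x s) - y‖)
      (nhdsWithin 0 (Ioi 0)) (nhds 0) := by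
    simpa using (hx.tendsto_slope_zero_right.sub_const y).norm
  have hmem₁ : ∀ᶠ d in nhdsWithin (0 : ℝ) (Ioi 0), (s + d, x s + d • y) ∈ W := by
    have : ContinuousAt (fun d : ℝ => (s + d, x s + d • y)) 0 := by fun_prop
    refine (this.mono_left nhdsWithin_le_nhds).eventually_mem ?_
    simpa using hW
  have hmem₂ : ∀ᶠ d in nhdsWithin (0 : ℝ) (Ioi 0), (s + d, x (s + d)) ∈ W := by
    have hsd : ContinuousAt (fun d : ℝ => s + d) 0 := by fun_prop
    have hxs : ContinuousAt (fun d : ℝ => x (s + d)) 0 :=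
      ContinuousAt.comp (g := x) (f := fun d : ℝ => s + d) (by simpa using hx.continuousAt) hsd
    refine ((hsd.prodMk hxs).mono_left nhdsWithin_le_nhds).eventually_mem ?_
    simpa using hW
  have herr : Tendsto (fun d : ℝ => (V (s + d) (x s + d • y) - V (s + d) (x (s + d))) / d)
      (nhdsWithin 0 (Ioi 0)) (nhds 0) := by
    refine squeeze_zero_norm' ?_ (by simpa using hx0.const_mul (K : ℝ))
    filter_upwards [hmem₁, hmem₂, self_mem_nhdsWithin] with d h₁ h₂ hd
    have hd0 : (0 : ℝ) < d := hd
    have hlip := hV.dist_le_mul _ h₁ _ h₂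
    rw [Real.dist_eq, Prod.dist_eq, dist_self, max_eq_right dist_nonneg, dist_comm,
      dist_eq_norm] at hlip
    have hsplit : x (s + d) - (x s + d • y) = d • (d⁻¹ • (x (s + d) - x s) - y) := by
      rw [smul_sub, smul_inv_smul₀ hd0.ne', sub_sub]
    rw [hsplit, norm_smul, Real.norm_of_nonneg hd0.le] at hlip
    rw [Real.norm_eq_abs, abs_div, abs_of_pos hd0, div_le_iff₀ hd0]
    linarith
  have hsum := hv0.add herr
  rw [add_zero] at hsum
  refine (hsum.congr fun d => ?_).limsup_eq
  rw [← add_div]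
  congr 1
  ring

lemma ae_deriv_comp_trajectory_eq_diniAlong {f : ℝ → Stt n → Stt m → Stt n} {u : ℝ → Stt m}
    (hab : a ≤ b) (hbc : b < c)
    (hV : LocLipschitzOn (Ico a c ×ˢ (univ : Set (Stt n))) (fun q : ℝ × Stt n => V q.1 q.2))
    (hF : IntegrableOn (fun s => f s (x s) (u s)) (Icc a b))
    (hx : ∀ s ∈ Icc a b, x s = x a + ∫ τ in a..s, f τ (x τ) (u τ)) :
    ∀ᵐ s ∂volume, s ∈ Ioo a b →
      deriv (fun s => V s (x s)) s = DiniAlong f V s (x s) (u s) := by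
  have hFi := (intervalIntegrable_iff_integrableOn_Icc_of_le hab).2 hF
  have hac := absolutelyContinuousOnInterval_comp_trajectory hab hbc hV hF hx
  filter_upwards [hac.ae_differentiableAt, hFi.ae_hasDerivAt_integral] with s hdv hdx hs
  rw [uIcc_of_le hab] at hdv hdx
  have hsI : s ∈ Icc a b := Ioo_subset_Icc_self hs
  have hxd : HasDerivAt x (f s (x s) (u s)) s := by
    refine ((hdx hsI a ⟨le_rfl, hab⟩).const_add (x a)).congr_of_eventuallyEq ?_
    filter_upwards [Icc_mem_nhds hs.1 hs.2] with τ hτ using hx τ hτ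
  obtain ⟨K, W, hW, hKW⟩ := hV (s, x s) ⟨⟨hsI.1, hsI.2.trans_lt hbc⟩, mem_univ _⟩
  rw [nhdsWithin_eq_nhds.2 (prod_mem_nhds (Ico_mem_nhds hs.1 (hs.2.trans hbc)) univ_mem)] at hW
  exact (diniAlong_eq_of_hasDerivAt hW hKW hxd (hdv hsI).hasDerivAt).symm

end Trajectory

lemma AbsolutelyContinuousOnInterval.flowOn {φ : ℝ → ℝ → ℝ} {v : ℝ → ℝ} {a b : ℝ} (hab : a ≤ b)
    (hv : AbsolutelyContinuousOnInterval v a b)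
    (hle : ∀ᵐ s ∂volume, s ∈ Ioo a b → deriv v s ≤ -φ s (v s)) : FlowOn φ v a b := by
  refine ⟨deriv v, (intervalIntegrable_iff_integrableOn_Icc_of_le hab).1
    hv.intervalIntegrable_deriv, ?_, fun t ht => ?_⟩
  · have ha : ∀ᵐ s ∂(volume : Measure ℝ), s ≠ a := by simp [ae_iff, measure_singleton]
    have hb : ∀ᵐ s ∂(volume : Measure ℝ), s ≠ b := by simp [ae_iff, measure_singleton]
    filter_upwards [hle, ha, hb] with s hs hsa hsb hsI
    exact hs ⟨lt_of_le_of_ne hsI.1 hsa.symm, lt_of_le_of_ne hsI.2 hsb⟩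
  · rw [(hv.mono (by
      rw [uIcc_of_le ht.1, uIcc_of_le hab]
      exact Icc_subset_Icc_right ht.2)).integral_deriv_eq_sub]
    ring

section InputNorm

variable {m : ℕ} {γ : Set ℝ} {u : ℝ → Stt m} {a b : ℝ}

lemma ae_norm_le_inputNorm (hu : IsInput u) (ha : 0 ≤ a) :
    ∀ᵐ s ∂volume, s ∈ Ioc a b → ‖u s‖ ≤ inputNorm γ u (Ioc a b) := by
  obtain ⟨C, hC⟩ := hu.2 b
  have hbdd : IsBoundedUnder (· ≤ ·) (ae (volume.restrict (Ioc a b))) fun s => ‖u s‖ := by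
    refine isBoundedUnder_of_eventually_le (a := C) ?_
    rw [ae_restrict_iff' measurableSet_Ioc]
    filter_upwards [hC] with s hs hsI
    exact hs ⟨ha.trans hsI.1.le, hsI.2⟩
  have := ae_le_essSup hbdd
  rw [ae_restrict_iff' measurableSet_Ioc] at this
  filter_upwards [this] with s hs hsI
  exact (hs hsI).trans (le_max_left _ _)

lemma norm_le_inputNorm_of_mem (hγ : IsImpulseSeq γ) {s : ℝ} (hsγ : s ∈ γ) (hs : s ∈ Ioc a b) :
    ‖u s‖ ≤ inputNorm γ u (Ioc a b) := by
  have hfin : (γ ∩ Ioc a b).Finite := (hγ.2 b).subset (inter_subset_inter_right _ fun t ht => ht.2)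
  have h := le_csSup (hfin.image fun t => ‖u t‖).bddAbove
    (mem_image_of_mem (fun t => ‖u t‖) ⟨hsγ, hs⟩)
  exact h.trans (le_max_right _ _)

lemma inputNorm_nonneg (γ : Set ℝ) (u : ℝ → Stt m) (I : Set ℝ) : 0 ≤ inputNorm γ u I := by
  refine le_max_of_le_right (Real.sSup_nonneg ?_)
  rintro _ ⟨s, -, rfl⟩
  exact norm_nonneg _

end InputNorm

/-- Along a trajectory, a Lyapunov-type function is bounded by the decaying comparison bound or by
a function of the input norm. -/
lemma IsSolution.lyapunov_le_or {n m : ℕ} {γ : Set ℝ} {f g : ℝ → Stt n → Stt m → Stt n}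
    {t0 t : ℝ} {x0 : Stt n} {u : ℝ → Stt m} {T : EReal} {x : ℝ → Stt n} {V Vm : ℝ → Stt n → ℝ}
    {φ al β : ℝ → ℝ → ℝ} {χ π : ℝ → ℝ}
    (hx : IsSolution γ f g t0 x0 u T x) (hγ : IsImpulseSeq γ) (hu : IsInput u)
    (ht0 : 0 ≤ t0) (ht : t0 ≤ t) (htT : (t : EReal) < T)
    (hφ : Caratheodory2 φ) (hβ : ClassKL β) (hB : CompBound γ φ al β)
    (hχ : ClassKInf χ) (hπ : ClassKInf π) (hV : InClassV γ V Vm)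
    (hnn : ∀ s ξ, 0 ≤ s → 0 ≤ V s ξ)
    (hD : ∀ s ξ μ, 0 ≤ s → s ∉ γ → χ ‖μ‖ ≤ V s ξ → DiniAlong f V s ξ μ ≤ -φ s (V s ξ))
    (hJ : ∀ s ξ μ, s ∈ γ → χ ‖μ‖ ≤ Vm s ξ → V s (ξ + g s ξ μ) ≤ al s (Vm s ξ))
    (hJ' : ∀ s ξ μ, s ∈ γ → Vm s ξ ≤ χ ‖μ‖ → V s (ξ + g s ξ μ) ≤ π ‖μ‖) :
    V t (x t) ≤ β (V t0 x0) (t - t0) ∨ V t (x t) ≤ χ (inputNorm γ u (Ioc t0 t)) ∨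
      V t (x t) ≤ β (χ (inputNorm γ u (Ioc t0 t))) 0 ∨
      V t (x t) ≤ β (π (inputNorm γ u (Ioc t0 t))) 0 := by
  have hlt : ∀ s ≤ t, (s : EReal) < T := fun s hs => (EReal.coe_le_coe_iff.2 hs).trans_lt htT
  have hint : ∀ t1 t2 : ℝ, t0 ≤ t1 → t1 ≤ t2 → t2 ≤ t → Ioc t1 t2 ∩ γ = ∅ →
      IntegrableOn (fun s => f s (x s) (u s)) (Icc t1 t2) ∧
      ∀ s ∈ Icc t1 t2, x s = x t1 + ∫ τ in t1..s, f τ (x τ) (u τ) := by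
    intro t1 t2 h1 h12 h2 he
    refine ⟨(hx.flow t1 t2 h1 h12 (hlt t2 h2) he).1, fun s hs => ?_⟩
    exact (hx.flow t1 s h1 hs.1 (hlt s (hs.2.trans h2))
      (subset_eq_empty (inter_subset_inter_left _ (Ioc_subset_Ioc_right hs.2)) he)).2
  rw [← hx.init]
  refine le_of_compBound_of_threshold (v := fun s => V s (x s)) hγ hφ hβ hB ht0 ht
    (fun s hs => hnn s _ (ht0.trans hs.1)) ?_ ?_ ?_
  · intro t1 t2 h1 h12 h2 he
    obtain ⟨c, hc, hec⟩ := hγ.exists_gt_Ioo_inter_eq_empty he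
    obtain ⟨hf, hxf⟩ := hint t1 t2 h1 h12 h2 he
    have := (absolutelyContinuousOnInterval_comp_trajectory h12 hc
      (hV.1 t1 c (ht0.trans h1) hec) hf hxf).continuousOn
    rwa [uIcc_of_le h12] at this
  · intro t1 t2 h1 h12 h2 he hcv
    obtain ⟨c, hc, hec⟩ := hγ.exists_gt_Ioo_inter_eq_empty he
    obtain ⟨hf, hxf⟩ := hint t1 t2 h1 h12 h2 he
    have hVc := hV.1 t1 c (ht0.trans h1) hec
    refine (absolutelyContinuousOnInterval_comp_trajectory h12 hc hVc hf hxf).flowOn h12 ?_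
    filter_upwards [ae_deriv_comp_trajectory_eq_diniAlong h12 hc hVc hf hxf,
      ae_norm_le_inputNorm (γ := γ) (b := t) hu ht0] with s hds hus hs
    rw [hds hs]
    have hs' : s ∈ Ioc t1 t2 := ⟨hs.1, hs.2.le⟩
    refine hD s (x s) (u s) (ht0.trans (h1.trans hs.1.le))
      (fun hsγ => eq_empty_iff_forall_notMem.1 he s ⟨hs', hsγ⟩) ?_
    exact (hχ.mono (norm_nonneg _) (hus ⟨h1.trans_lt hs.1, hs'.2.trans h2⟩)).trans (hcv s hs')
  · intro τ hτ h1 h2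
    obtain ⟨L, hL, hxτ⟩ := hx.jump τ hτ h1 (hlt τ h2)
    have hus := norm_le_inputNorm_of_mem (u := u) hγ hτ ⟨h1, h2⟩
    refine ⟨Vm τ L, (hV.2 τ hτ L).comp (f := fun s => (s, x s))
      (tendsto_nhdsWithin_iff.2 ⟨?_, ?_⟩), fun hc => ?_, fun _ => ?_⟩
    · exact (tendsto_id.mono_left nhdsWithin_le_nhds).prodMk_nhds hL
    · filter_upwards [self_mem_nhdsWithin] with s hs using ⟨hs, mem_univ _⟩
    · simp only [hxτ]
      exact hJ τ L (u τ) hτ ((hχ.mono (norm_nonneg _) hus).trans hc)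
    · simp only [hxτ]
      exact (le_total (χ ‖u τ‖) (Vm τ L)).imp (hJ τ L (u τ) hτ)
        fun h => (hJ' τ L (u τ) hτ h).trans (hπ.mono (norm_nonneg _) hus)

/-- Theorem 1 (weak case): if the comparison family is weakly GUAS then the
family of impulsive systems is weakly `(h⁰,h)`-ISS. -/
theorem stmt1 {n m : ℕ} {Λ : Type*} (γ : Λ → Set ℝ)
    (f g : Λ → ℝ → Stt n → Stt m → Stt n)
    (hγ : ∀ l : Λ, IsImpulseSeq (γ l))
    (h0 h : ℝ → Stt n → ℝ)
    (hh0 : ∀ (t : ℝ) (ξ : Stt n), 0 ≤ t → 0 ≤ h0 t ξ)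
    (hh : ∀ (t : ℝ) (ξ : Stt n), 0 ≤ t → 0 ≤ h t ξ)
    (V Vm : Λ → ℝ → Stt n → ℝ) (φ1 φ2 χ π : ℝ → ℝ)
    (vφ al : Λ → ℝ → ℝ → ℝ)
    (hA1 : Assumption1 γ f g h0 h V Vm φ1 φ2 χ π vφ al)
    (hGUAS : CompWeakGUAS γ vφ al) :
    WeaklyISS γ f g h0 h := by
  obtain ⟨h1, h2, hχ, hπ, hV, hφ, -, hbd, hD, hJ, hJ'⟩ := hA1
  obtain ⟨β, hβ, hB⟩ := hGUAS
  obtain ⟨ψ, hψ, hinv⟩ := h1.exists_leftInverse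
  have hβ0 := hβ.1 0 le_rfl
  refine ⟨_, _, hβ.comp_comp hψ h2,
    hψ.comp (hχ.add ((hβ0.comp hχ).add (hβ0.comp hπ))), ?_⟩
  intro l t0 x0 u T x ht0 hu hx t ht htT
  have hnn : ∀ s ξ, 0 ≤ s → 0 ≤ V l s ξ := fun s ξ hs =>
    (h1.nonneg (hh s ξ hs)).trans (hbd l s ξ hs).1
  have hr := inputNorm_nonneg (γ l) u (Ioc t0 t)
  have hcases := hx.1.lyapunov_le_or (hγ l) hu ht0 ht htT (hφ l) hβ (hB l) hχ hπ (hV l) hnn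
    (hD l) (hJ l) (hJ' l)
  have ht' := ht0.trans ht
  have hφ1 := (hbd l t (x t) ht').1
  have hφ1' := h1.nonneg (hh t (x t) ht')
  have hβt := hβ.1 _ (sub_nonneg.2 ht)
  have e1 := hχ.nonneg hr
  have e2 := hβ0.nonneg e1
  have e3 := hβ0.nonneg (hπ.nonneg hr)
  have e4 := hβt.nonneg (h2.nonneg (hh0 t0 x0 ht0))
  rw [← hinv _ (hh t (x t) ht')]
  rcases hcases with hv | hv
  · refine (hψ.mono hφ1' (hφ1.trans (hv.trans ?_))).trans
      (le_add_of_nonneg_right (hψ.nonneg (by positivity)))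
    exact hβt.mono (hnn t0 x0 ht0) (hbd l t0 x0 ht0).2
  · refine (hψ.mono hφ1' (hφ1.trans ?_)).trans (le_add_of_nonneg_left (hψ.nonneg e4))
    rcases hv with hv | hv | hv <;> linarith

end
end
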